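/- For every N ≥ 3 and every q ∈ [0,1], the probability of success of the W-state anonymous transmission protocol under N-fold depolarizing noise equals Tr[𝒟_q^{⊗N}(|W_N⟩⟨W_N|)·(1⊗P₀)] = (q+1)^{N−3}·(N(1−q)+4q) / (N·2^{N−2}). -/

import Mathlib

open Finset

/-- The N-qubit W state: amplitude `1/√N` on strings with exactly one coordinate
equal to 1, and 0 otherwise. -/
noncomputable def Wstate (N : ℕ) (x : Fin N → Fin 2) : ℂ :=
  if (∑ i, (x i : ℕ)) = 1 then ((1 / Real.sqrt N : ℝ) : ℂ) else 0

/-- The N-fold depolarizing channel with parameter q: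
𝒟_q^{⊗N}(ρ) = Σ_{S ⊆ Fin N} q^{N−|S|}(1−q)^{|S|} Φ_S(ρ), where Φ_S replaces
the qubits in S by the maximally mixed state. -/
noncomputable def depolarize (N : ℕ) (q : ℝ)
    (ρ : (Fin N → Fin 2) → (Fin N → Fin 2) → ℂ) (x y : Fin N → Fin 2) : ℂ :=
  ∑ S : Finset (Fin N),
    ((q ^ (N - S.card) * (1 - q) ^ S.card : ℝ) : ℂ) *
      (if ∀ i ∈ S, x i = y i then
        ((2 : ℂ) ^ S.card)⁻¹ *
          ∑ z : {i // i ∈ S} → Fin 2,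
            ρ (fun j => if h : j ∈ S then z ⟨j, h⟩ else x j)
              (fun j => if h : j ∈ S then z ⟨j, h⟩ else y j)
      else 0)

/-- On the diagonal of a product density, the depolarizing channel acts factor by factor. -/
theorem depolarize_prod_diag (N : ℕ) (q : ℝ) (f : Fin N → Fin 2 → ℂ)
    (ρ : (Fin N → Fin 2) → (Fin N → Fin 2) → ℂ) (hρ : ∀ w, ρ w w = ∏ j, f j (w j))
    (x : Fin N → Fin 2) :
    depolarize N q ρ x x = ∏ j, ((1 - q : ℂ) / 2 * ∑ b, f j b + q * f j (x j)) := by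
  rw [Finset.prod_add, Finset.powerset_univ, depolarize]
  refine Finset.sum_congr rfl fun S _ => ?_
  have hz : ∑ z : {i // i ∈ S} → Fin 2, ∏ j, f j (if h : j ∈ S then z ⟨j, h⟩ else x j) =
      (∏ j ∈ S, ∑ b, f j b) * ∏ j ∈ univ \ S, f j (x j) := by
    have hsplit (z : {i // i ∈ S} → Fin 2) :
        ∏ j, f j (if h : j ∈ S then z ⟨j, h⟩ else x j) =
          (∏ j : {i // i ∈ S}, f j (z j)) * ∏ j ∈ univ \ S, f j (x j) := by
      rw [← Finset.prod_sdiff (Finset.subset_univ S), mul_comm, ← Finset.prod_coe_sort S]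
      congr 1
      · exact Finset.prod_congr rfl fun j _ => by simp
      · exact Finset.prod_congr rfl fun j hj => by
          rw [dif_neg (Finset.mem_sdiff.mp hj).2]
    simp_rw [hsplit, ← Finset.sum_mul]
    rw [← Finset.prod_coe_sort S, Fintype.prod_sum]
  simp only [hρ, implies_true, if_true]
  rw [hz, Finset.prod_mul_distrib, Finset.prod_mul_distrib, Finset.prod_const, Finset.prod_const,
    Finset.card_sdiff_of_subset (Finset.subset_univ S), Finset.card_univ, Fintype.card_fin, div_pow]
  push_cast
  ring

/-- The channel is linear in the density. -/
theorem depolarize_sum {ι : Type*} (s : Finset ι) (N : ℕ) (q : ℝ)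
    (ρ : ι → (Fin N → Fin 2) → (Fin N → Fin 2) → ℂ) (c : ℂ) (x y : Fin N → Fin 2) :
    depolarize N q (fun u v => c * ∑ k ∈ s, ρ k u v) x y =
      c * ∑ k ∈ s, depolarize N q (ρ k) x y := by
  simp only [depolarize]
  rw [Finset.sum_comm, Finset.mul_sum]
  refine Finset.sum_congr rfl fun S _ => ?_
  split_ifs
  · rw [← Finset.mul_sum, ← Finset.mul_sum, ← Finset.mul_sum, Finset.sum_comm]
    ring
  · simp

/-- The diagonal of the channel's output depends only on the diagonal of its input. -/
theorem depolarize_diag_congr (N : ℕ) (q : ℝ) {ρ σ : (Fin N → Fin 2) → (Fin N → Fin 2) → ℂ}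
    (h : ∀ w, ρ w w = σ w w) (x : Fin N → Fin 2) :
    depolarize N q ρ x x = depolarize N q σ x x := by
  simp only [depolarize, h]

theorem sum_val_eq_one_iff {N : ℕ} (w : Fin N → Fin 2) :
    ∑ i, (w i : ℕ) = 1 ↔ ∃ k, w = Pi.single k 1 := by
  constructor
  · intro h
    obtain ⟨k, hk⟩ : ∃ k, w k ≠ 0 := by
      by_contra! hc
      simp [hc] at h
    refine ⟨k, funext fun j => ?_⟩
    rw [← Finset.add_sum_erase _ _ (Finset.mem_univ k)] at h
    have hk1 : w k = 1 := by omega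
    by_cases hj : j = k
    · subst hj; simpa using hk1
    · have h0 : ∑ i ∈ univ.erase k, (w i : ℕ) = 0 := by
        rw [hk1] at h
        simpa using h
      have := Finset.sum_eq_zero_iff.mp h0 j (by simp [hj])
      rw [Pi.single_eq_of_ne hj]
      exact Fin.ext this
  · rintro ⟨k, rfl⟩
    rw [Finset.sum_eq_single k] <;> simp +contextual [Pi.single_eq_of_ne]

/-- The populations of the W state form the uniform mixture of the weight-one strings. -/
theorem Wstate_mul_conj_self (N : ℕ) (w : Fin N → Fin 2) :
    Wstate N w * (starRingEnd ℂ) (Wstate N w) =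
      (N : ℂ)⁻¹ * ∑ k, ∏ j, if w j = (Pi.single k 1 : Fin N → Fin 2) j then (1 : ℂ) else 0 := by
  have hprod (k : Fin N) :
      (∏ j, if w j = (Pi.single k 1 : Fin N → Fin 2) j then (1 : ℂ) else 0) =
        if w = Pi.single k 1 then 1 else 0 := by
    rw [Finset.prod_ite_zero]
    simp [funext_iff]
  simp_rw [hprod, Wstate, sum_val_eq_one_iff]
  split_ifs with h
  · obtain ⟨k, rfl⟩ := h
    have hinj (l : Fin N) :
        (Pi.single k 1 : Fin N → Fin 2) = Pi.single l 1 ↔ k = l := by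
      refine ⟨fun h => ?_, fun h => h ▸ rfl⟩
      by_contra hkl
      have := congrFun h k
      simp [Pi.single_eq_of_ne hkl] at this
    simp only [hinj, Finset.sum_ite_eq, Finset.mem_univ, if_true, mul_one]
    rw [Complex.conj_ofReal, ← Complex.ofReal_mul, div_mul_div_comm, one_mul,
      Real.mul_self_sqrt (Nat.cast_nonneg N)]
    simp
  · rw [Finset.sum_eq_zero fun k _ => if_neg fun hk => h ⟨k, hk⟩]
    simp

/-- The probability that a depolarized weight-one string is `0` outside the first two qubits,
as a product over the qubits. -/
theorem sum_depolarize_single (N : ℕ) (q : ℝ) (k : Fin N) :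
    ∑ x ∈ Finset.univ.filter (fun x : Fin N → Fin 2 => ∀ i : Fin N, 2 ≤ (i : ℕ) → x i = 0),
      depolarize N q (fun u _ =>
        ∏ j, if u j = (Pi.single k 1 : Fin N → Fin 2) j then (1 : ℂ) else 0) x x =
    ∏ j : Fin N, if 2 ≤ (j : ℕ) then (if j = k then (1 - q : ℂ) / 2 else (1 + q) / 2) else 1 := by
  have hfilter :
      (Finset.univ.filter fun x : Fin N → Fin 2 => ∀ i : Fin N, 2 ≤ (i : ℕ) → x i = 0) =
        Fintype.piFinset fun i : Fin N => if 2 ≤ (i : ℕ) then {0} else univ := by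
    ext x
    simp only [Finset.mem_filter, Finset.mem_univ, true_and, Fintype.mem_piFinset]
    refine forall_congr' fun i => ?_
    split_ifs with h <;> simp [h]
  rw [hfilter, Finset.sum_congr rfl fun x _ => depolarize_prod_diag N q
    (fun j b => if b = (Pi.single k 1 : Fin N → Fin 2) j then (1 : ℂ) else 0) _ (fun _ => rfl) x,
    ← Finset.prod_univ_sum (fun i : Fin N => if 2 ≤ (i : ℕ) then {0} else univ)
      (fun j b => (1 - q : ℂ) / 2 *
        ∑ c, (if c = (Pi.single k 1 : Fin N → Fin 2) j then (1 : ℂ) else 0) +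
          q * if b = (Pi.single k 1 : Fin N → Fin 2) j then (1 : ℂ) else 0)]
  refine Finset.prod_congr rfl fun j _ => ?_
  by_cases h : 2 ≤ (j : ℕ)
  · by_cases hj : j = k
    · subst hj
      simp [h]
    · simp [h, hj]
      ring
  · simp only [h, if_false, Finset.sum_add_distrib, ← Finset.mul_sum, Finset.sum_ite_eq',
      Finset.mem_univ, if_true, Finset.sum_const, Finset.card_univ, Fintype.card_fin]
    simp

/-- The probability of success of the W-state protocol under N-fold
depolarizing noise:
Tr[𝒟_q^{⊗N}(|W_N⟩⟨W_N|)·(1⊗P₀)] = (q+1)^{N−3}·(N(1−q)+4q) / (N·2^{N−2}). -/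
theorem W_depolarizing_success_probability (N : ℕ) (hN : 3 ≤ N)
    (q : ℝ) (hq : q ∈ Set.Icc (0 : ℝ) 1) :
    (∑ x ∈ Finset.univ.filter
        (fun x : Fin N → Fin 2 => ∀ i : Fin N, 2 ≤ (i : ℕ) → x i = 0),
      depolarize N q (fun x y => Wstate N x * (starRingEnd ℂ) (Wstate N y)) x x)
    = (((q + 1) ^ (N - 3) * (N * (1 - q) + 4 * q) / (N * 2 ^ (N - 2)) : ℝ) : ℂ) := by
  simp_rw [depolarize_diag_congr N q
    (ρ := fun u v => Wstate N u * (starRingEnd ℂ) (Wstate N v))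
    (σ := fun u _ => (N : ℂ)⁻¹ *
      ∑ k, ∏ j, if u j = (Pi.single k 1 : Fin N → Fin 2) j then (1 : ℂ) else 0)
    (Wstate_mul_conj_self N), depolarize_sum, ← Finset.mul_sum]
  rw [Finset.sum_comm, Finset.sum_congr rfl fun k _ => sum_depolarize_single N q k]
  obtain ⟨M, rfl⟩ := Nat.exists_eq_add_of_le' hN
  have hne : (M : ℂ) + 3 ≠ 0 := by exact_mod_cast (M + 2).succ_ne_zero
  have hlast (l : Fin (M + 1)) :
      (∏ j, if j = l then (1 - q : ℂ) / 2 else (1 + q) / 2) =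
        (1 - q) / 2 * ((1 + q) / 2) ^ M := by
    rw [← Finset.mul_prod_erase _ _ (Finset.mem_univ l), if_pos rfl,
      Finset.prod_congr rfl fun j hj => if_neg (Finset.ne_of_mem_erase hj), Finset.prod_const,
      Finset.card_erase_of_mem (Finset.mem_univ l), Finset.card_univ, Fintype.card_fin,
      Nat.add_sub_cancel]
  have hone (x : Fin (M + 1)) : x.succ.succ ≠ 1 := fun h =>
    Fin.succ_ne_zero x (Fin.succ_injective _ h)
  rw [Fin.sum_univ_succ, Fin.sum_univ_succ]
  simp [Fin.prod_univ_succ (n := M + 2), Fin.prod_univ_succ (n := M + 1), Fin.succ_ne_zero,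
    hlast, hone, div_pow]
  field_simp
  ring
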